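/- Let (L,Δ,S) and (L',Δ',S') be localities, and let β : L → L' be a projection of localities from (L,Δ,S) to (L',Δ',S') with ker(β) ⊆ Z(L). Let (L_0,Δ_0,S_0) be a sublocality of (L,Δ,S). Then (L_0β, Δ_0β, S_0β) is a sublocality of (L',Δ',S') and β|_{L_0} : L_0 → L_0β is a projection of localities from (L_0,Δ_0,S_0) to (L_0β,Δ_0β,S_0β). -/

import Mathlib

/-!
Background definitions for partial groups and localities in the sense of Chermak.

A *partial group* is given by `Data`: a domain `D` of words, a (total, but only
meaningful on `D`) product `pi : List L → L`, and an inversion map, subject to the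
axioms collected in `IsPartialGroup`.
-/

namespace PartialGroups

/-- The underlying data of a partial group. -/
structure Data (L : Type*) where
  /-- The domain of the product, a set of words. -/
  D : Set (List L)
  /-- The product `Π`, meaningful on `D`. -/
  pi : List L → L
  /-- The inversion map. -/
  inv : L → L

variable {L L' L₁ L₂ L₁' L₂' : Type*}

/-- The formal inverse of a word: `(f₁,…,fₙ)⁻¹ = (fₙ⁻¹,…,f₁⁻¹)`. -/
def Data.wInv (P : Data L) (w : List L) : List L := (w.map P.inv).reverse

/-- The identity element `1 = Π(∅)`. -/
def Data.one (P : Data L) : L := P.pi []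

/-- The axioms of a partial group. -/
structure IsPartialGroup (P : Data L) : Prop where
  /-- Inversion is an involution (in particular a bijection). -/
  inv_inv : ∀ f : L, P.inv (P.inv f) = f
  /-- `L ⊆ D` (words of length one lie in the domain). -/
  singleton_mem : ∀ f : L, [f] ∈ P.D
  /-- `u ∘ v ∈ D` implies `u ∈ D`. -/
  append_left : ∀ u v : List L, u ++ v ∈ P.D → u ∈ P.D
  /-- `u ∘ v ∈ D` implies `v ∈ D`. -/
  append_right : ∀ u v : List L, u ++ v ∈ P.D → v ∈ P.D
  /-- `Π` restricts to the identity on words of length one. -/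
  pi_singleton : ∀ f : L, P.pi [f] = f
  /-- `u ∘ v ∘ w ∈ D` implies `u ∘ (Π(v)) ∘ w ∈ D`. -/
  assoc_mem : ∀ u v w : List L, u ++ v ++ w ∈ P.D → u ++ [P.pi v] ++ w ∈ P.D
  /-- `Π(u ∘ v ∘ w) = Π(u ∘ (Π(v)) ∘ w)`. -/
  assoc_pi : ∀ u v w : List L, u ++ v ++ w ∈ P.D →
    P.pi (u ++ v ++ w) = P.pi (u ++ [P.pi v] ++ w)
  /-- `w ∈ D` implies `w⁻¹ ∘ w ∈ D`. -/
  wInv_mem : ∀ w ∈ P.D, P.wInv w ++ w ∈ P.D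
  /-- `Π(w⁻¹ ∘ w) = 1`. -/
  wInv_pi : ∀ w ∈ P.D, P.pi (P.wInv w ++ w) = P.one

/-- `D(g)`: the set of `x` for which `x^g` is defined. -/
def Data.Dconj (P : Data L) (g : L) : Set L := {x | [P.inv g, x, g] ∈ P.D}

/-- Conjugation `x^g = Π(g⁻¹, x, g)`. -/
def Data.conj (P : Data L) (x g : L) : L := P.pi [P.inv g, x, g]

/-- `X^g = {x^g : x ∈ X}`. -/
def Data.conjSet (P : Data L) (X : Set L) (g : L) : Set L := (fun x => P.conj x g) '' X

/-- `W(H)`: the set of words with all entries in `H`. -/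
def Wrd (H : Set L) : Set (List L) := {w | ∀ x ∈ w, x ∈ H}

/-- The centralizer `C_L(X) = {g : x ∈ D(g) and x^g = x for all x ∈ X}`. -/
def Data.centralizer (P : Data L) (X : Set L) : Set L :=
  {g | ∀ x ∈ X, x ∈ P.Dconj g ∧ P.conj x g = x}

/-- The center `Z(L) = C_L(L)`. -/
def Data.center (P : Data L) : Set L := P.centralizer Set.univ

/-- The normalizer `N_L(X) = {g : X ⊆ D(g) and X^g = X}`. -/
def Data.normalizer (P : Data L) (X : Set L) : Set L :=
  {g | X ⊆ P.Dconj g ∧ P.conjSet X g = X}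

/-- The centralizer of `X` computed inside the partial subgroup `L₀`. -/
def Data.centralizerIn (P : Data L) (L₀ X : Set L) : Set L := L₀ ∩ P.centralizer X

/-- The center of the partial subgroup `L₀` (with its restricted partial product). -/
def Data.centerIn (P : Data L) (L₀ : Set L) : Set L := P.centralizerIn L₀ L₀

/-- The set product `XY = {Π(x,y) : x ∈ X, y ∈ Y, (x,y) ∈ D}`. -/
def Data.setMul (P : Data L) (X Y : Set L) : Set L :=
  {z | ∃ x ∈ X, ∃ y ∈ Y, [x, y] ∈ P.D ∧ P.pi [x, y] = z}

/-- `S_g = {s ∈ S ∩ D(g) : s^g ∈ S}`. -/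
def Data.SOf (P : Data L) (S : Set L) (g : L) : Set L :=
  {s | s ∈ S ∧ s ∈ P.Dconj g ∧ P.conj s g ∈ S}

/-- A partial subgroup: closed under inversion and under products of words in the domain. -/
def Data.IsPartialSubgroup (P : Data L) (H : Set L) : Prop :=
  (∀ f ∈ H, P.inv f ∈ H) ∧ ∀ w ∈ Wrd H ∩ P.D, P.pi w ∈ H

/-- A subgroup: a partial subgroup `H` with `W(H) ⊆ D`. -/
def Data.IsSubgroup (P : Data L) (H : Set L) : Prop :=
  P.IsPartialSubgroup H ∧ Wrd H ⊆ P.D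

/-- A `p`-subgroup: a subgroup whose order is a power of `p`. -/
def Data.IsPSubgroup (p : ℕ) (P : Data L) (H : Set L) : Prop :=
  P.IsSubgroup H ∧ ∃ n : ℕ, H.ncard = p ^ n

/-- A partial normal subgroup: `n^f ∈ N` for all `f ∈ L` and `n ∈ N ∩ D(f)`. -/
def Data.IsPartialNormal (P : Data L) (N : Set L) : Prop :=
  P.IsPartialSubgroup N ∧ ∀ f : L, ∀ n ∈ N, n ∈ P.Dconj f → P.conj n f ∈ N

/-- A homomorphism of partial groups: `Dβ* ⊆ D'` and `Π'(vβ*) = (Π(v))β`. -/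
def IsHom (P : Data L) (P' : Data L') (β : L → L') : Prop :=
  (∀ w ∈ P.D, w.map β ∈ P'.D) ∧ ∀ w ∈ P.D, P'.pi (w.map β) = β (P.pi w)

/-- A projection of partial groups: a homomorphism with `Dβ* = D'`. -/
def IsProjection (P : Data L) (P' : Data L') (β : L → L') : Prop :=
  IsHom P P' β ∧ ∀ w' ∈ P'.D, ∃ w ∈ P.D, w.map β = w'

/-- An isomorphism of partial groups: an injective projection. -/
def IsIsomorphism (P : Data L) (P' : Data L') (β : L → L') : Prop :=
  IsProjection P P' β ∧ Function.Injective β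

/-- The kernel `ker(β) = {f : fβ = 1'}`. -/
def pgKer (P : Data L) (P' : Data L') (β : L → L') : Set L := {f | β f = P'.one}

/-- `β` restricted to the partial subgroup `L₀` is a homomorphism of partial groups
(the source being `L₀` with the restricted product). -/
def IsHomBetween (P : Data L) (P' : Data L') (L₀ : Set L) (β : L → L') : Prop :=
  (∀ w ∈ P.D ∩ Wrd L₀, w.map β ∈ P'.D) ∧
    ∀ w ∈ P.D ∩ Wrd L₀, P'.pi (w.map β) = β (P.pi w)

/-- `β` restricted to a map `L₀ → L₀'` is a projection of partial groups between
the restricted partial groups on `L₀` and `L₀'` (so `(D ∩ W(L₀))β* = D' ∩ W(L₀')`). -/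
def IsProjBetween (P : Data L) (P' : Data L') (L₀ : Set L) (L₀' : Set L') (β : L → L') :
    Prop :=
  β '' L₀ = L₀' ∧ IsHomBetween P P' L₀ β ∧
    ∀ w' ∈ P'.D ∩ Wrd L₀', ∃ w ∈ P.D ∩ Wrd L₀, w.map β = w'

/-- `β` restricted to a map `L₀ → L₀'` is an isomorphism of partial groups. -/
def IsIsoBetween (P : Data L) (P' : Data L') (L₀ : Set L) (L₀' : Set L') (β : L → L') :
    Prop :=
  IsProjBetween P P' L₀ L₀' β ∧ Set.InjOn β L₀

/-- `chainFrom P Δ w Q` means: the word `w` lies in `D_Δ` via the chain starting at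
`P₀ = Q`, i.e. there are `P₀,…,Pₙ ∈ Δ` with `P_{i-1} ⊆ D(f_i)` and `P_{i-1}^{f_i} = P_i`. -/
def chainFrom (P : Data L) (Δ : Set (Set L)) : List L → Set L → Prop
  | [], _ => True
  | f :: w, Q => Q ⊆ P.Dconj f ∧ P.conjSet Q f ∈ Δ ∧ chainFrom P Δ w (P.conjSet Q f)

/-- The set of words `D_Δ`. -/
def DDelta (P : Data L) (Δ : Set (Set L)) : Set (List L) :=
  {w | ∃ Q ∈ Δ, chainFrom P Δ w Q}

/-- `(L,Δ,S)` is a locality (for the prime `p`). -/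
structure IsLocality (p : ℕ) (P : Data L) (Δ : Set (Set L)) (S : Set L) : Prop where
  isPartialGroup : IsPartialGroup P
  /-- `L` is finite as a set. -/
  finite : Finite L
  /-- `S` is a `p`-subgroup of `L`. -/
  pSubgroup : P.IsPSubgroup p S
  /-- `Δ` is nonempty. -/
  delta_nonempty : Δ.Nonempty
  /-- `Δ` is a set of subgroups of `S`. -/
  delta_subgroups : ∀ Q ∈ Δ, P.IsSubgroup Q ∧ Q ⊆ S
  /-- (L1): `S` is maximal among the `p`-subgroups of `L`. -/
  s_maximal : ∀ T : Set L, P.IsPSubgroup p T → S ⊆ T → T = S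
  /-- (L2): `D = D_Δ`. -/
  d_eq : P.D = DDelta P Δ
  /-- (L3): overgroups in `S` of conjugates of members of `Δ` lie in `Δ`. -/
  delta_closed : ∀ Q : Set L, P.IsSubgroup Q → Q ⊆ S →
    (∃ R ∈ Δ, ∃ g : L, R ⊆ P.Dconj g ∧ P.conjSet R g ⊆ Q) → Q ∈ Δ

/-- `(L₀,Δ,S)` is a locality, where `L₀` is a partial subgroup of the ambient partial
group and `L₀` is regarded as a partial group with the restricted product.  All the
conditions are expressed via the ambient product (with which the restricted one
agrees on words in `W(L₀)`). -/
structure IsLocalityIn (p : ℕ) (P : Data L) (L₀ : Set L) (Δ : Set (Set L)) (S : Set L) :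
    Prop where
  partialSubgroup : P.IsPartialSubgroup L₀
  /-- `L₀` is finite as a set. -/
  finite : L₀.Finite
  /-- `S` is a `p`-subgroup. -/
  pSubgroup : P.IsPSubgroup p S
  s_sub : S ⊆ L₀
  delta_nonempty : Δ.Nonempty
  delta_subgroups : ∀ Q ∈ Δ, P.IsSubgroup Q ∧ Q ⊆ S
  /-- (L1) for the restriction. -/
  s_maximal : ∀ T : Set L, T ⊆ L₀ → P.IsPSubgroup p T → S ⊆ T → T = S
  /-- (L2) for the restriction. -/
  d_eq : ∀ w ∈ Wrd L₀, (w ∈ P.D ↔ w ∈ DDelta P Δ)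
  /-- (L3) for the restriction. -/
  delta_closed : ∀ Q : Set L, P.IsSubgroup Q → Q ⊆ S →
    (∃ R ∈ Δ, ∃ g ∈ L₀, R ⊆ P.Dconj g ∧ P.conjSet R g ⊆ Q) → Q ∈ Δ

/-- `(L₀,Δ₀,S₀)` is a sublocality of a locality with Sylow subgroup `S`. -/
def IsSubLocality (p : ℕ) (P : Data L) (S : Set L) (L₀ : Set L) (Δ₀ : Set (Set L))
    (S₀ : Set L) : Prop :=
  S₀ = S ∩ L₀ ∧ IsLocalityIn p P L₀ Δ₀ S₀

/-- A projection of localities: a projection of partial groups with `Δβ = Δ'`. -/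
def IsLocalityProj (P : Data L) (P' : Data L') (Δ : Set (Set L)) (Δ' : Set (Set L'))
    (β : L → L') : Prop :=
  IsProjection P P' β ∧ Set.image β '' Δ = Δ'

/-- `β` restricted to `L₀ → L₀'` is a projection of localities. -/
def IsLocalityProjBetween (P : Data L) (P' : Data L') (L₀ : Set L) (Δ₀ : Set (Set L))
    (L₀' : Set L') (Δ₀' : Set (Set L')) (β : L → L') : Prop :=
  IsProjBetween P P' L₀ L₀' β ∧ Set.image β '' Δ₀ = Δ₀'

/-- The right coset `Nf = {Π(n,f) : n ∈ N, (n,f) ∈ D}`. -/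
def rightCoset (P : Data L) (N : Set L) (f : L) : Set L :=
  {y | ∃ n ∈ N, [n, f] ∈ P.D ∧ P.pi [n, f] = y}

/-- The data of the external direct product of two partial groups:  the domain consists
of the words whose words of first resp. second coordinates lie in the respective domains,
and the product and the inversion are computed coordinatewise. -/
def prodData (P₁ : Data L₁) (P₂ : Data L₂) : Data (L₁ × L₂) where
  D := {u | u.map Prod.fst ∈ P₁.D ∧ u.map Prod.snd ∈ P₂.D}
  pi := fun u => (P₁.pi (u.map Prod.fst), P₂.pi (u.map Prod.snd))
  inv := fun f => (P₁.inv f.1, P₂.inv f.2)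

/-- `Δ₁ * Δ₂`: the set of subgroups of `S₁ × S₂` containing some `P₁ × P₂` with
`P_i ∈ Δ_i`. -/
def deltaStar (P₁ : Data L₁) (P₂ : Data L₂) (Δ₁ : Set (Set L₁)) (Δ₂ : Set (Set L₂))
    (S₁ : Set L₁) (S₂ : Set L₂) : Set (Set (L₁ × L₂)) :=
  {Q | (prodData P₁ P₂).IsSubgroup Q ∧ Q ⊆ S₁ ×ˢ S₂ ∧
    ∃ R₁ ∈ Δ₁, ∃ R₂ ∈ Δ₂, R₁ ×ˢ R₂ ⊆ Q}

/-- `K` is a normal `p`-subgroup of the subgroup `M` of the ambient partial group. -/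
def Data.IsNormalPSubgroupIn (p : ℕ) (P : Data L) (M K : Set L) : Prop :=
  K ⊆ M ∧ P.IsSubgroup K ∧ (∃ n : ℕ, K.ncard = p ^ n) ∧
    ∀ f ∈ M, ∀ x ∈ K, x ∈ P.Dconj f ∧ P.conj x f ∈ K

/-- `O_p(M)`: the largest normal `p`-subgroup of the subgroup `M` (the union of all
normal `p`-subgroups of `M`). -/
def Data.pCoreIn (p : ℕ) (P : Data L) (M : Set L) : Set L :=
  ⋃₀ {K | P.IsNormalPSubgroupIn p M K}

/-- The subgroup `M` of the ambient partial group is of characteristic `p`: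
`C_M(O_p(M)) ≤ O_p(M)`. -/
def Data.IsCharPSubgroup (p : ℕ) (P : Data L) (M : Set L) : Prop :=
  P.centralizerIn M (P.pCoreIn p M) ⊆ P.pCoreIn p M

/-- A locality is of objective characteristic `p` if `N_L(Q)` is of characteristic `p`
for every `Q ∈ Δ`. -/
def IsObjectiveCharP (p : ℕ) (P : Data L) (Δ : Set (Set L)) : Prop :=
  ∀ Q ∈ Δ, P.IsCharPSubgroup p (P.normalizer Q)

/-- The word `(Π(f₁,g₁),…,Π(fₙ,gₙ))` built from the words `u = (f₁,…,fₙ)` and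
`v = (g₁,…,gₙ)`. -/
def zipProd (P : Data L) (u v : List L) : List L :=
  List.zipWith (fun f g => P.pi [f, g]) u v

/-- `L` is the internal central product of `M₁` and `M₂`: conditions (C1) and (C2). -/
def IsInternalCentralProduct (P : Data L) (M₁ M₂ : Set L) : Prop :=
  (P.D = {w | ∃ u v : List L, u ∈ P.D ∩ Wrd M₁ ∧ v ∈ P.D ∩ Wrd M₂ ∧
      u.length = v.length ∧ (∀ q ∈ u.zip v, [q.1, q.2] ∈ P.D) ∧ w = zipProd P u v}) ∧
  ∀ u v : List L, u ∈ P.D ∩ Wrd M₁ → v ∈ P.D ∩ Wrd M₂ → u.length = v.length →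
    (∀ q ∈ u.zip v, [q.1, q.2] ∈ P.D) →
    P.pi (zipProd P u v) = P.pi [P.pi u, P.pi v]

/-- `L` is the internal direct product of `M₁` and `M₂`: (C1), (C2) and (D). -/
def IsInternalDirectProduct (P : Data L) (M₁ M₂ : Set L) : Prop :=
  IsInternalCentralProduct P M₁ M₂ ∧
    ∀ h : L, ∃! fg : L × L, fg.1 ∈ M₁ ∧ fg.2 ∈ M₂ ∧ [fg.1, fg.2] ∈ P.D ∧
      P.pi [fg.1, fg.2] = h

namespace IsPartialGroup

variable {P : Data L}

theorem nil_mem (hP : IsPartialGroup P) : [] ∈ P.D := by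
  have := hP.append_left [] [P.one] (by simpa using hP.singleton_mem P.one)
  exact this

theorem insert_one_mem (hP : IsPartialGroup P) (u v : List L) (h : u ++ v ∈ P.D) :
    u ++ [P.one] ++ v ∈ P.D :=
  hP.assoc_mem u [] v (by simpa using h)

theorem insert_one_pi (hP : IsPartialGroup P) (u v : List L) (h : u ++ v ∈ P.D) :
    P.pi (u ++ [P.one] ++ v) = P.pi (u ++ v) := by
  have := hP.assoc_pi u [] v (by simpa using h)
  simpa [Data.one] using this.symm

theorem one_mul (hP : IsPartialGroup P) (a : L) : P.pi [P.one, a] = a := by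
  have := hP.insert_one_pi [] [a] (hP.singleton_mem a)
  simpa [hP.pi_singleton] using this

theorem mul_one (hP : IsPartialGroup P) (a : L) : P.pi [a, P.one] = a := by
  have := hP.insert_one_pi [a] [] (hP.singleton_mem a)
  simpa [hP.pi_singleton] using this

theorem pi_cons (hP : IsPartialGroup P) {a : L} {w : List L} (h : a :: w ∈ P.D) :
    P.pi (a :: w) = P.pi [a, P.pi w] := by
  simpa using hP.assoc_pi [a] w [] (by simpa using h)

theorem cons_mem (hP : IsPartialGroup P) {a : L} {w : List L} (h : a :: w ∈ P.D) :
    [a, P.pi w] ∈ P.D := by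
  simpa using hP.assoc_mem [a] w [] (by simpa using h)

theorem wInv_wInv (hP : IsPartialGroup P) (w : List L) : P.wInv (P.wInv w) = w := by
  simp [Data.wInv, hP.inv_inv, Function.comp_def]

theorem wInv_mem_D (hP : IsPartialGroup P) {w : List L} (h : w ∈ P.D) : P.wInv w ∈ P.D :=
  hP.append_left _ _ (hP.wInv_mem w h)

theorem append_wInv_mem (hP : IsPartialGroup P) {w : List L} (h : w ∈ P.D) :
    w ++ P.wInv w ∈ P.D := by
  simpa [hP.wInv_wInv] using hP.wInv_mem _ (hP.wInv_mem_D h)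

theorem append_wInv_pi (hP : IsPartialGroup P) {w : List L} (h : w ∈ P.D) :
    P.pi (w ++ P.wInv w) = P.one := by
  simpa [hP.wInv_wInv] using hP.wInv_pi _ (hP.wInv_mem_D h)

theorem inv_mul_mem (hP : IsPartialGroup P) (a : L) : [P.inv a, a] ∈ P.D :=
  hP.wInv_mem [a] (hP.singleton_mem a)

theorem inv_mul (hP : IsPartialGroup P) (a : L) : P.pi [P.inv a, a] = P.one :=
  hP.wInv_pi [a] (hP.singleton_mem a)

theorem mul_inv_mem (hP : IsPartialGroup P) (a : L) : [a, P.inv a] ∈ P.D :=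
  hP.append_wInv_mem (hP.singleton_mem a)

theorem mul_inv (hP : IsPartialGroup P) (a : L) : P.pi [a, P.inv a] = P.one :=
  hP.append_wInv_pi (hP.singleton_mem a)

/-- `a⁻¹ (a b) = b`. -/
theorem inv_mul_cancel_left (hP : IsPartialGroup P) {a b : L} (h : [a, b] ∈ P.D) :
    P.pi [P.inv a, P.pi [a, b]] = b := by
  have h3 : [P.inv a, a, b] ∈ P.D :=
    hP.append_right [P.inv b] _ (by simpa [Data.wInv] using hP.wInv_mem _ h)
  have e1 := hP.assoc_pi [] [P.inv a, a] [b] (by simpa using h3)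
  have e2 := hP.assoc_pi [P.inv a] [a, b] [] (by simpa using h3)
  simp only [List.nil_append, List.append_nil, List.cons_append, hP.inv_mul,
    hP.one_mul] at e1 e2
  rw [← e2, e1]

/-- `(a b⁻¹) b = a`. -/
theorem mul_inv_cancel_right (hP : IsPartialGroup P) {a b : L} (h : [a, P.inv b] ∈ P.D) :
    [P.pi [a, P.inv b], b] ∈ P.D ∧ P.pi [P.pi [a, P.inv b], b] = a := by
  have h3 : [a, P.inv b, b] ∈ P.D :=
    hP.append_left _ [P.inv a] (by simpa [Data.wInv, hP.inv_inv] using hP.append_wInv_mem h)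
  have e1 := hP.assoc_pi [] [a, P.inv b] [b] (by simpa using h3)
  have e2 := hP.assoc_pi [a] [P.inv b, b] [] (by simpa using h3)
  have m1 := hP.assoc_mem [] [a, P.inv b] [b] (by simpa using h3)
  simp only [List.nil_append, List.append_nil, List.cons_append, hP.inv_mul,
    hP.mul_one] at e1 e2 m1
  exact ⟨m1, by rw [← e1, e2]⟩

theorem eq_inv_of_mul_eq_one (hP : IsPartialGroup P) {a b : L} (h : [a, b] ∈ P.D)
    (h1 : P.pi [a, b] = P.one) : b = P.inv a := by
  rw [← hP.inv_mul_cancel_left h, h1, hP.mul_one]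

theorem pi_wInv (hP : IsPartialGroup P) {w : List L} (h : w ∈ P.D) :
    P.pi (P.wInv w) = P.inv (P.pi w) := by
  have h0 := hP.append_wInv_mem h
  have h1 := hP.assoc_mem [] w (P.wInv w) (by simpa using h0)
  have e1 := hP.assoc_pi [] w (P.wInv w) (by simpa using h0)
  simp only [List.nil_append, List.cons_append] at h1 e1
  apply hP.eq_inv_of_mul_eq_one (hP.cons_mem h1)
  rw [← hP.pi_cons h1, ← e1, hP.append_wInv_pi h]

theorem inv_one (hP : IsPartialGroup P) : P.inv P.one = P.one := by
  rw [← hP.one_mul (P.inv P.one), hP.mul_inv]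

theorem one_mem_Dconj (hP : IsPartialGroup P) (f : L) : P.one ∈ P.Dconj f :=
  hP.insert_one_mem [P.inv f] [f] (hP.inv_mul_mem f)

theorem one_conj (hP : IsPartialGroup P) (f : L) : P.conj P.one f = P.one :=
  (hP.insert_one_pi [P.inv f] [f] (hP.inv_mul_mem f)).trans (hP.inv_mul f)

theorem mem_Dconj_one (hP : IsPartialGroup P) (x : L) : x ∈ P.Dconj P.one := by
  have h := hP.insert_one_mem [] [x] (hP.singleton_mem x)
  simpa [Data.Dconj, hP.inv_one] using hP.insert_one_mem [P.one, x] [] (by simpa using h)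

theorem conj_one (hP : IsPartialGroup P) (x : L) : P.conj x P.one = x := by
  have h := hP.insert_one_mem [] [x] (hP.singleton_mem x)
  have := hP.insert_one_pi [P.one, x] [] (by simpa using h)
  simp only [List.append_nil, List.cons_append, List.nil_append, hP.one_mul] at this
  simpa [Data.conj, hP.inv_one] using this

theorem inv_mem_Dconj (hP : IsPartialGroup P) {x f : L} (h : x ∈ P.Dconj f) :
    P.inv x ∈ P.Dconj f := by
  have := hP.wInv_mem_D h
  simpa [Data.wInv, hP.inv_inv, Data.Dconj] using this

theorem inv_conj (hP : IsPartialGroup P) {x f : L} (h : x ∈ P.Dconj f) :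
    P.conj (P.inv x) f = P.inv (P.conj x f) := by
  have := hP.pi_wInv h
  simpa [Data.wInv, hP.inv_inv, Data.conj] using this

theorem conj_cancel_word_mem (hP : IsPartialGroup P) {x f : L} (h : x ∈ P.Dconj f) :
    [f, P.inv f, x, f, P.inv f] ∈ P.D := by
  have h1 : [f, P.inv f, x, f] ∈ P.D :=
    hP.append_right [P.inv f, P.inv x] _
      (by simpa [Data.wInv, hP.inv_inv] using hP.wInv_mem _ h)
  exact hP.append_left _ [P.inv x, f, P.inv f]
    (by simpa [Data.wInv, hP.inv_inv] using hP.append_wInv_mem h1)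

theorem conj_mem_Dconj_inv (hP : IsPartialGroup P) {x f : L} (h : x ∈ P.Dconj f) :
    P.conj x f ∈ P.Dconj (P.inv f) := by
  have := hP.assoc_mem [f] [P.inv f, x, f] [P.inv f] (hP.conj_cancel_word_mem h)
  simpa [Data.Dconj, Data.conj, hP.inv_inv] using this

theorem conj_conj_inv (hP : IsPartialGroup P) {x f : L} (h : x ∈ P.Dconj f) :
    P.conj (P.conj x f) (P.inv f) = x := by
  have h0 := hP.conj_cancel_word_mem h
  have e := hP.assoc_pi [f] [P.inv f, x, f] [P.inv f] h0
  have h1 := hP.assoc_mem [] [f, P.inv f] [x, f, P.inv f] h0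
  have e1 := hP.assoc_pi [] [f, P.inv f] [x, f, P.inv f] h0
  have e2 := hP.assoc_pi [P.one, x] [f, P.inv f] [] (by simpa [hP.mul_inv] using h1)
  have h3 := hP.insert_one_mem [] [x] (hP.singleton_mem x)
  have e3 := hP.insert_one_pi [P.one, x] [] (by simpa using h3)
  simp only [List.cons_append, List.nil_append, List.append_nil, hP.mul_inv, hP.one_mul]
    at e e1 e2 e3
  simp only [Data.conj, hP.inv_inv]
  rw [← e, e1, e2, e3]

theorem conj_inv_conj (hP : IsPartialGroup P) {x f : L} (h : x ∈ P.Dconj (P.inv f)) :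
    P.conj (P.conj x (P.inv f)) f = x := by
  simpa [hP.inv_inv] using hP.conj_conj_inv h

/-- If `(f⁻¹, x, f, f⁻¹, y, f) ∈ D`, then `x^f y^f = (x y)^f`. -/
theorem conj_mul (hP : IsPartialGroup P) {x y f : L}
    (h : [P.inv f, x, f, P.inv f, y, f] ∈ P.D) :
    P.pi [x, y] ∈ P.Dconj f ∧
      P.conj (P.pi [x, y]) f = P.pi [P.conj x f, P.conj y f] := by
  have h1 := hP.assoc_mem [] [P.inv f, x, f] [P.inv f, y, f] h
  have e1 := hP.assoc_pi [] [P.inv f, x, f] [P.inv f, y, f] h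
  have e2 := hP.assoc_pi [P.conj x f] [P.inv f, y, f] [] (by simpa [Data.conj] using h1)
  have h3 := hP.assoc_mem [P.inv f, x] [f, P.inv f] [y, f] h
  have e3 := hP.assoc_pi [P.inv f, x] [f, P.inv f] [y, f] h
  rw [hP.mul_inv] at h3 e3
  have h4 := hP.assoc_mem [P.inv f] [x, P.one] [y, f] (by simpa using h3)
  have e4 := hP.assoc_pi [P.inv f] [x, P.one] [y, f] (by simpa using h3)
  rw [hP.mul_one] at h4 e4
  have h5 := hP.assoc_mem [P.inv f] [x, y] [f] (by simpa using h4)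
  have e5 := hP.assoc_pi [P.inv f] [x, y] [f] (by simpa using h4)
  simp only [List.cons_append, List.nil_append, List.append_nil] at *
  refine ⟨h5, ?_⟩
  change P.pi _ = _
  rw [← e5, ← e4, ← e3, e1]
  exact e2

/-- If `(g⁻¹, f⁻¹, x, f, g) ∈ D`, then `(x^f)^g = x^(f g)`. -/
theorem conj_conj (hP : IsPartialGroup P) {x f g : L} (hfg : [f, g] ∈ P.D)
    (h : [P.inv g, P.inv f, x, f, g] ∈ P.D) :
    x ∈ P.Dconj (P.pi [f, g]) ∧ P.conj x (P.pi [f, g]) = P.conj (P.conj x f) g := by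
  have e1 := hP.assoc_pi [P.inv g] [P.inv f, x, f] [g] h
  have h2 := hP.assoc_mem [] [P.inv g, P.inv f] [x, f, g] h
  have e2 := hP.assoc_pi [] [P.inv g, P.inv f] [x, f, g] h
  have h3 := hP.assoc_mem [P.pi [P.inv g, P.inv f], x] [f, g] [] (by simpa using h2)
  have e3 := hP.assoc_pi [P.pi [P.inv g, P.inv f], x] [f, g] [] (by simpa using h2)
  have hi : P.pi [P.inv g, P.inv f] = P.inv (P.pi [f, g]) := by
    simpa [Data.wInv] using hP.pi_wInv hfg
  rw [hi] at e2 h3 e3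
  simp only [List.cons_append, List.nil_append, List.append_nil] at *
  refine ⟨h3, ?_⟩
  change P.pi _ = P.pi _
  rw [← e3, ← e2, e1]
  rfl

end IsPartialGroup

namespace Data.IsSubgroup

variable {P : Data L} {H K : Set L}

theorem inv_mem (hH : P.IsSubgroup H) {a : L} (ha : a ∈ H) : P.inv a ∈ H := hH.1.1 a ha

theorem word_mem (hH : P.IsSubgroup H) {w : List L} (hw : ∀ a ∈ w, a ∈ H) : w ∈ P.D := hH.2 hw

theorem pi_mem (hH : P.IsSubgroup H) {w : List L} (hw : ∀ a ∈ w, a ∈ H) : P.pi w ∈ H :=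
  hH.1.2 w ⟨hw, hH.2 hw⟩

theorem one_mem (hH : P.IsSubgroup H) : P.one ∈ H := hH.pi_mem (w := []) (by simp)

theorem mul_mem (hH : P.IsSubgroup H) {a b : L} (ha : a ∈ H) (hb : b ∈ H) : P.pi [a, b] ∈ H :=
  hH.pi_mem (by simp [ha, hb])

theorem mem_Dconj (hH : P.IsSubgroup H) {a b : L} (ha : a ∈ H) (hb : b ∈ H) :
    a ∈ P.Dconj b :=
  hH.word_mem (by simp [ha, hb, hH.inv_mem])

theorem conj_mem (hH : P.IsSubgroup H) {a b : L} (ha : a ∈ H) (hb : b ∈ H) : P.conj a b ∈ H :=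
  hH.pi_mem (by simp [ha, hb, hH.inv_mem])

theorem of_closed (hP : IsPartialGroup P) (hK : Wrd H ⊆ P.D)
    (h1 : P.one ∈ H) (hinv : ∀ a ∈ H, P.inv a ∈ H)
    (hmul : ∀ a ∈ H, ∀ b ∈ H, P.pi [a, b] ∈ H) : P.IsSubgroup H := by
  refine ⟨⟨hinv, ?_⟩, hK⟩
  rintro w ⟨hw, hD⟩
  induction w with
  | nil => exact h1
  | cons a w ih =>
    have hw' : ∀ x ∈ w, x ∈ H := fun x hx => hw x (List.mem_cons_of_mem _ hx)
    rw [hP.pi_cons hD]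
    exact hmul _ (hw a List.mem_cons_self) _ (ih hw' (hK hw'))

theorem of_subset (hP : IsPartialGroup P) (hK : P.IsSubgroup K) (hHK : H ⊆ K)
    (h1 : P.one ∈ H) (hinv : ∀ a ∈ H, P.inv a ∈ H)
    (hmul : ∀ a ∈ H, ∀ b ∈ H, P.pi [a, b] ∈ H) : P.IsSubgroup H :=
  of_closed hP (fun _ hw => hK.2 fun x hx => hHK (hw x hx)) h1 hinv hmul

/-- The group structure on a subgroup of a partial group. -/
abbrev group (hH : P.IsSubgroup H) (hP : IsPartialGroup P) : Group H :=
  letI : Mul H := ⟨fun a b => ⟨P.pi [a.1, b.1], hH.mul_mem a.2 b.2⟩⟩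
  letI : One H := ⟨⟨P.one, hH.one_mem⟩⟩
  letI : Inv H := ⟨fun a => ⟨P.inv a.1, hH.inv_mem a.2⟩⟩
  Group.ofLeftAxioms
    (fun a b c => by
      have h : [a.1, b.1, c.1] ∈ P.D := hH.word_mem (by simp)
      have e1 := hP.assoc_pi [] [a.1, b.1] [c.1] h
      have e2 := hP.assoc_pi [a.1] [b.1, c.1] [] (by simpa using h)
      exact Subtype.ext (e1.symm.trans e2))
    (fun a => Subtype.ext (hP.one_mul a.1))
    (fun a => Subtype.ext (hP.inv_mul a.1))

/-- A subgroup of the partial group, intersected with a subgroup `H`, as a subgroup of the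
group `H`. -/
def subgroupOf (hK : P.IsSubgroup K) (hH : P.IsSubgroup H) (hP : IsPartialGroup P) :
    letI := hH.group hP
    Subgroup H :=
  letI := hH.group hP
  { carrier := {x | x.1 ∈ K}
    mul_mem' := fun ha hb => hK.mul_mem ha hb
    one_mem' := hK.one_mem
    inv_mem' := fun ha => hK.inv_mem ha }

theorem image_val (hH : P.IsSubgroup H) (hP : IsPartialGroup P) :
    letI := hH.group hP
    ∀ K : Subgroup H, P.IsSubgroup (Subtype.val '' (K : Set H)) := by
  let := hH.group hP
  intro K
  refine of_subset hP hH (by rintro _ ⟨x, -, rfl⟩; exact x.2) ⟨1, K.one_mem, rfl⟩ ?_ ?_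
  · rintro _ ⟨x, hx, rfl⟩
    exact ⟨x⁻¹, K.inv_mem hx, rfl⟩
  · rintro _ ⟨x, hx, rfl⟩ _ ⟨y, hy, rfl⟩
    exact ⟨x * y, K.mul_mem hx hy, rfl⟩

end Data.IsSubgroup

/-- `f` conjugates the object `A` to the object `B`. -/
structure ConjRel (P : Data L) (Δ : Set (Set L)) (f : L) (A B : Set L) : Prop where
  left_mem : A ∈ Δ
  right_mem : B ∈ Δ
  subset_Dconj : A ⊆ P.Dconj f
  conjSet_eq : P.conjSet A f = B

theorem ConjRel.conj_mem {P : Data L} {Δ : Set (Set L)} {f x : L} {A B : Set L}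
    (h : ConjRel P Δ f A B) (hx : x ∈ A) : P.conj x f ∈ B :=
  h.conjSet_eq ▸ ⟨x, hx, rfl⟩

theorem conjRel_of_mem_center {P : Data L} {Δ : Set (Set L)} {A : Set L} (hA : A ∈ Δ) {z : L}
    (hz : z ∈ P.center) : ConjRel P Δ z A A := by
  refine ⟨hA, hA, fun x _ => (hz x trivial).1, ?_⟩
  calc P.conjSet A z = id '' A := Set.image_congr fun x _ => (hz x trivial).2
    _ = A := Set.image_id A

/-- The word `w` conjugates `A` to `B` through a chain of objects. -/
inductive ConjPath (P : Data L) (Δ : Set (Set L)) : List L → Set L → Set L → Prop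
  | nil {A : Set L} : A ∈ Δ → ConjPath P Δ [] A A
  | cons {f : L} {w : List L} {A B C : Set L} :
      ConjRel P Δ f A B → ConjPath P Δ w B C → ConjPath P Δ (f :: w) A C

theorem ConjRel.path {P : Data L} {Δ : Set (Set L)} {f : L} {A B : Set L}
    (h : ConjRel P Δ f A B) : ConjPath P Δ [f] A B :=
  .cons h (.nil h.right_mem)

theorem chainFrom_iff {P : Data L} {Δ : Set (Set L)} {w : List L} {A : Set L} (hA : A ∈ Δ) :
    chainFrom P Δ w A ↔ ∃ B, ConjPath P Δ w A B := by
  induction w generalizing A with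
  | nil => exact ⟨fun _ => ⟨A, .nil hA⟩, fun _ => trivial⟩
  | cons f w ih =>
    constructor
    · rintro ⟨h1, h2, h3⟩
      obtain ⟨B, hB⟩ := (ih h2).1 h3
      exact ⟨B, .cons ⟨hA, h2, h1, rfl⟩ hB⟩
    · rintro ⟨B, _ | ⟨h1, h2⟩⟩
      obtain ⟨-, hC, h3, rfl⟩ := h1
      exact ⟨h3, hC, (ih hC).2 ⟨B, h2⟩⟩

namespace IsLocality

variable {p : ℕ} {P : Data L} {Δ : Set (Set L)} {S : Set L}

theorem mem_D_iff (h : IsLocality p P Δ S) {w : List L} :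
    w ∈ P.D ↔ ∃ A B, ConjPath P Δ w A B := by
  rw [h.d_eq]
  constructor
  · rintro ⟨A, hA, hc⟩
    exact ⟨A, (chainFrom_iff hA).1 hc⟩
  · rintro ⟨A, B, hB⟩
    have hA : A ∈ Δ := by
      cases hB with
      | nil hA => exact hA
      | cons hf _ => exact hf.left_mem
    exact ⟨A, hA, (chainFrom_iff hA).2 ⟨B, hB⟩⟩

theorem mem_D_of_path (h : IsLocality p P Δ S) {w : List L} {A B : Set L}
    (hw : ConjPath P Δ w A B) : w ∈ P.D :=
  h.mem_D_iff.2 ⟨A, B, hw⟩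

theorem exists_conjRel (h : IsLocality p P Δ S) (f : L) : ∃ A B, ConjRel P Δ f A B := by
  obtain ⟨A, B, hw⟩ := h.mem_D_iff.1 (h.isPartialGroup.singleton_mem f)
  cases hw with
  | cons hf _ => exact ⟨_, _, hf⟩

theorem conjRel_inv (h : IsLocality p P Δ S) {f : L} {A B : Set L} (hf : ConjRel P Δ f A B) :
    ConjRel P Δ (P.inv f) B A := by
  have hP := h.isPartialGroup
  obtain ⟨hA, hB, hs, rfl⟩ := hf
  refine ⟨hB, hA, ?_, ?_⟩
  · rintro _ ⟨x, hx, rfl⟩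
    exact hP.conj_mem_Dconj_inv (hs hx)
  · ext y
    constructor
    · rintro ⟨_, ⟨x, hx, rfl⟩, rfl⟩
      simpa only [hP.conj_conj_inv (hs hx)] using hx
    · intro hy
      exact ⟨_, ⟨y, hy, rfl⟩, hP.conj_conj_inv (hs hy)⟩

theorem conjSet_eq_self (h : IsLocality p P Δ S) {A : Set L} (hA : P.IsSubgroup A) {x : L}
    (hx : x ∈ A) : P.conjSet A x = A := by
  have hP := h.isPartialGroup
  ext y
  constructor
  · rintro ⟨a, ha, rfl⟩
    exact hA.conj_mem ha hx
  · intro hy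
    exact ⟨_, hA.conj_mem hy (hA.inv_mem hx),
      hP.conj_inv_conj (hA.mem_Dconj hy (hA.inv_mem hx))⟩

theorem conjRel_self (h : IsLocality p P Δ S) {A : Set L} (hA : A ∈ Δ) {x : L} (hx : x ∈ A) :
    ConjRel P Δ x A A :=
  have hs := (h.delta_subgroups A hA).1
  ⟨hA, hA, fun _ ha => hs.mem_Dconj ha hx, h.conjSet_eq_self hs hx⟩

theorem conjRel_mul (h : IsLocality p P Δ S) {f g : L} {A B C : Set L}
    (hf : ConjRel P Δ f A B) (hg : ConjRel P Δ g B C) : ConjRel P Δ (P.pi [f, g]) A C := by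
  have hP := h.isPartialGroup
  have key : ∀ x ∈ A, x ∈ P.Dconj (P.pi [f, g]) ∧
      P.conj x (P.pi [f, g]) = P.conj (P.conj x f) g := fun x hx =>
    hP.conj_conj (h.mem_D_of_path (.cons hf hg.path))
      (h.mem_D_of_path (.cons (h.conjRel_inv hg) (.cons (h.conjRel_inv hf)
        (.cons (h.conjRel_self hf.left_mem hx) (.cons hf hg.path)))))
  refine ⟨hf.left_mem, hg.right_mem, fun x hx => (key x hx).1, ?_⟩
  rw [← hg.conjSet_eq, ← hf.conjSet_eq, Data.conjSet, Data.conjSet, Data.conjSet, Set.image_image]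
  exact Set.image_congr fun x hx => (key x hx).2

theorem conj_mul_of_conjRel (h : IsLocality p P Δ S) {f : L} {A B : Set L}
    (hf : ConjRel P Δ f A B) {x y : L} (hx : x ∈ A) (hy : y ∈ A) :
    P.conj (P.pi [x, y]) f = P.pi [P.conj x f, P.conj y f] :=
  have hf' := h.conjRel_inv hf
  (h.isPartialGroup.conj_mul (h.mem_D_of_path (.cons hf' (.cons (h.conjRel_self hf.left_mem hx)
    (.cons hf (.cons hf' (.cons (h.conjRel_self hf.left_mem hy) hf.path))))))).2

theorem isSubgroup_conjSet (h : IsLocality p P Δ S) {f : L} {A B Q : Set L}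
    (hf : ConjRel P Δ f A B) (hQ : P.IsSubgroup Q) (hQA : Q ⊆ A) :
    P.IsSubgroup (P.conjSet Q f) := by
  have hP := h.isPartialGroup
  refine .of_subset hP (h.delta_subgroups B hf.right_mem).1 ?_ ?_ ?_ ?_
  · rintro _ ⟨x, hx, rfl⟩
    exact hf.conj_mem (hQA hx)
  · exact ⟨P.one, hQ.one_mem, hP.one_conj f⟩
  · rintro _ ⟨x, hx, rfl⟩
    exact ⟨_, hQ.inv_mem hx, hP.inv_conj (hf.subset_Dconj (hQA hx))⟩
  · rintro _ ⟨x, hx, rfl⟩ _ ⟨y, hy, rfl⟩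
    exact ⟨_, hQ.mul_mem hx hy, h.conj_mul_of_conjRel hf (hQA hx) (hQA hy)⟩

theorem mem_of_subset (h : IsLocality p P Δ S) {A Q : Set L} (hA : A ∈ Δ)
    (hQ : P.IsSubgroup Q) (hAQ : A ⊆ Q) (hQS : Q ⊆ S) : Q ∈ Δ := by
  have hP := h.isPartialGroup
  refine h.delta_closed Q hQ hQS ⟨A, hA, P.one, fun x _ => hP.mem_Dconj_one x, ?_⟩
  rintro _ ⟨x, hx, rfl⟩
  simpa only [hP.conj_one x] using hAQ hx

theorem s_mem (h : IsLocality p P Δ S) : S ∈ Δ :=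
  have ⟨A, hA⟩ := h.delta_nonempty
  h.mem_of_subset hA h.pSubgroup.1 (h.delta_subgroups A hA).2 subset_rfl

theorem conjRel_of_mem (h : IsLocality p P Δ S) {A : Set L} (hA : A ∈ Δ) {s : L}
    (hs : s ∈ S) : ConjRel P Δ s A (P.conjSet A s) := by
  have hS := h.pSubgroup.1
  obtain ⟨hA1, hA2⟩ := h.delta_subgroups A hA
  have hd : A ⊆ P.Dconj s := fun x hx => hS.mem_Dconj (hA2 hx) hs
  refine ⟨hA, h.delta_closed _ (h.isSubgroup_conjSet (h.conjRel_self h.s_mem hs) hA1 hA2) ?_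
    ⟨A, hA, s, hd, subset_rfl⟩, hd, rfl⟩
  rintro _ ⟨x, hx, rfl⟩
  exact hS.conj_mem (hA2 hx) hs

theorem conj_mem_SOf_inv (h : IsLocality p P Δ S) {f x : L} (hx : x ∈ P.SOf S f) :
    P.conj x f ∈ P.SOf S (P.inv f) :=
  have hP := h.isPartialGroup
  ⟨hx.2.2, hP.conj_mem_Dconj_inv hx.2.1, (hP.conj_conj_inv hx.2.1).symm ▸ hx.1⟩

/-- If `f` conjugates `A` to `B` and `x ∈ S_f`, then `f` conjugates `A^x` to `B^(x^f)`. -/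
theorem conjRel_translate (h : IsLocality p P Δ S) {f x : L} {A B : Set L}
    (hf : ConjRel P Δ f A B) (hx : x ∈ P.SOf S f) :
    ConjRel P Δ f (P.conjSet A x) (P.conjSet B (P.conj x f)) := by
  have hP := h.isPartialGroup
  obtain ⟨hxS, hxD, hyS⟩ := hx
  have h1 := h.conjRel_inv (h.conjRel_of_mem hf.left_mem hxS)
  have h2 := h.conjRel_of_mem hf.right_mem hyS
  have h3 := h.conjRel_mul h1 (h.conjRel_mul hf h2)
  have key : P.pi [P.inv x, P.pi [f, P.conj x f]] = f := by
    have w1 : [f, P.inv f, x, f] ∈ P.D := hP.append_left _ [P.inv f] (hP.conj_cancel_word_mem hxD)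
    have e1 := hP.assoc_pi [f] [P.inv f, x, f] [] (by simpa using w1)
    have e2 := hP.assoc_pi [] [f, P.inv f] [x, f] w1
    have m3 := hP.append_right [f, P.inv f] [x, f] w1
    have e3 := hP.insert_one_pi [] [x, f] m3
    rw [hP.mul_inv] at e2
    simp only [List.cons_append, List.nil_append, List.append_nil] at e1 e2 e3
    change P.pi [P.inv x, P.pi [f, P.pi [P.inv f, x, f]]] = f
    rw [← e1, e2, e3, hP.inv_mul_cancel_left m3]
  rwa [key] at h3

theorem isSubgroup_SOf (h : IsLocality p P Δ S) (f : L) : P.IsSubgroup (P.SOf S f) := by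
  have hP := h.isPartialGroup
  have hS := h.pSubgroup.1
  refine .of_subset hP hS (fun _ hx => hx.1) ?_ ?_ ?_
  · exact ⟨hS.one_mem, hP.one_mem_Dconj f, (hP.one_conj f).symm ▸ hS.one_mem⟩
  · rintro x ⟨h1, h2, h3⟩
    exact ⟨hS.inv_mem h1, hP.inv_mem_Dconj h2, (hP.inv_conj h2).symm ▸ hS.inv_mem h3⟩
  · intro x hx y hy
    obtain ⟨A, B, hf⟩ := h.exists_conjRel f
    have hfx := h.conjRel_translate hf hx
    have hfy := h.conjRel_translate hfx hy
    have := hP.conj_mul (h.mem_D_of_path (.cons (h.conjRel_inv hf)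
      (.cons (h.conjRel_of_mem hf.left_mem hx.1) (.cons hfx (.cons (h.conjRel_inv hfx)
        (.cons (h.conjRel_of_mem hfx.left_mem hy.1) hfy.path))))))
    exact ⟨hS.mul_mem hx.1 hy.1, this.1, this.2 ▸ hS.mul_mem hx.2.2 hy.2.2⟩

theorem subset_SOf (h : IsLocality p P Δ S) {f : L} {A B : Set L} (hf : ConjRel P Δ f A B) :
    A ⊆ P.SOf S f := fun _ hx =>
  ⟨(h.delta_subgroups A hf.left_mem).2 hx, hf.subset_Dconj hx,
    (h.delta_subgroups B hf.right_mem).2 (hf.conj_mem hx)⟩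

theorem SOf_mem (h : IsLocality p P Δ S) (f : L) : P.SOf S f ∈ Δ :=
  have ⟨_, _, hf⟩ := h.exists_conjRel f
  h.mem_of_subset hf.left_mem (h.isSubgroup_SOf f) (h.subset_SOf hf) fun _ hx => hx.1

theorem conjRel_SOf (h : IsLocality p P Δ S) (f : L) :
    ConjRel P Δ f (P.SOf S f) (P.SOf S (P.inv f)) := by
  have hP := h.isPartialGroup
  refine ⟨h.SOf_mem f, h.SOf_mem _, fun _ hx => hx.2.1, ?_⟩
  ext y
  constructor
  · rintro ⟨x, hx, rfl⟩
    exact h.conj_mem_SOf_inv hx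
  · intro hy
    refine ⟨_, ?_, hP.conj_inv_conj hy.2.1⟩
    simpa [hP.inv_inv] using h.conj_mem_SOf_inv hy

end IsLocality

theorem _root_.IsPGroup.exists_mem_normalizer {p : ℕ} [Fact p.Prime] {G : Type*} [Group G]
    [Finite G] (hG : IsPGroup p G) {A B : Subgroup G} (hAB : A < B) :
    ∃ y ∈ B, y ∉ A ∧ y ∈ Subgroup.normalizer (A : Set G) := by
  have : Group.IsNilpotent B := (hG.to_subgroup B).isNilpotent
  have hlt : A.subgroupOf B < ⊤ := by
    rw [lt_top_iff_ne_top, Ne, Subgroup.subgroupOf_eq_top]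
    exact not_le_of_gt hAB
  obtain ⟨y, hy, hyA⟩ := SetLike.exists_of_lt (Group.normalizerCondition_of_isNilpotent _ hlt)
  refine ⟨y, y.2, hyA, ?_⟩
  rw [Subgroup.mem_normalizer_iff] at hy ⊢
  intro h
  constructor
  · intro hh
    exact (hy ⟨h, hAB.le hh⟩).1 hh
  · intro hh
    have hB : h ∈ B := by
      have := B.mul_mem (B.mul_mem (B.inv_mem y.2) (hAB.le hh)) y.2
      simpa [mul_assoc] using this
    exact (hy ⟨h, hB⟩).2 hh

theorem Data.IsPSubgroup.isPGroup {p : ℕ} [Fact p.Prime] {P : Data L} {H : Set L}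
    (hH : P.IsPSubgroup p H) (hP : IsPartialGroup P) :
    letI := hH.1.group hP
    IsPGroup p H :=
  have ⟨_, hn⟩ := hH.2
  letI := hH.1.group hP
  IsPGroup.of_card ((Nat.card_coe_set_eq H).trans hn)

theorem Data.IsSubgroup.isPSubgroup_image_val {p : ℕ} [Fact p.Prime] {P : Data L} {T : Set L}
    (hT : P.IsSubgroup T) (hP : IsPartialGroup P) [Finite T] :
    letI := hT.group hP
    ∀ K : Subgroup T, IsPGroup p K → P.IsPSubgroup p (Subtype.val '' (K : Set T)) := by
  let := hT.group hP
  intro K hK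
  obtain ⟨n, hn⟩ := IsPGroup.iff_card.1 hK
  refine ⟨hT.image_val hP K, n, ?_⟩
  rw [Set.ncard_image_of_injective _ Subtype.val_injective, ← hn]
  exact (Nat.card_coe_set_eq _).symm

/-- A `p`-subgroup `R ⊆ T` which is maximal among the `p`-subgroups contained in the finite
subgroup `T` is a Sylow subgroup of the group `T`. -/
theorem Data.IsSubgroup.exists_sylow {p : ℕ} [Fact p.Prime] {P : Data L} {T R : Set L}
    (hT : P.IsSubgroup T) (hP : IsPartialGroup P) [Finite T] (hR : P.IsPSubgroup p R)
    (hRT : R ⊆ T) (hmax : ∀ X ⊆ T, P.IsPSubgroup p X → R ⊆ X → X = R) :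
    letI := hT.group hP
    ∃ Q : Sylow p T, ∀ x : T, x ∈ Q ↔ x.1 ∈ R := by
  let := hT.group hP
  obtain ⟨n, hn⟩ := hR.2
  have hcard : Nat.card (hR.1.subgroupOf hT hP) = p ^ n := by
    have himg : Subtype.val '' ((hR.1.subgroupOf hT hP : Subgroup T) : Set T) = R :=
      Set.Subset.antisymm (by rintro _ ⟨x, hx, rfl⟩; exact hx) fun x hx => ⟨⟨x, hRT hx⟩, hx, rfl⟩
    have h1 := Set.ncard_image_of_injective ((hR.1.subgroupOf hT hP : Subgroup T) : Set T)
      Subtype.val_injective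
    exact (Nat.card_coe_set_eq _).trans (h1.symm.trans ((congrArg Set.ncard himg).trans hn))
  refine ⟨⟨hR.1.subgroupOf hT hP, IsPGroup.of_card hcard, ?_⟩, fun x => Iff.rfl⟩
  intro K hK hle
  have := hmax _ (by rintro _ ⟨x, -, rfl⟩; exact x.2) (hT.isPSubgroup_image_val hP K hK)
    fun x hx => ⟨⟨x, hRT hx⟩, hle hx, rfl⟩
  refine le_antisymm (fun x hx => ?_) hle
  change x.1 ∈ R
  rw [← this]
  exact ⟨x, hx, rfl⟩

theorem exists_word_map_eq {β : L → L'} {H : Set L} {w : List L'} (hw : w ∈ Wrd (β '' H)) :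
    ∃ v ∈ Wrd H, v.map β = w := by
  have : w ∈ Set.range (List.map fun x : H => β x) := by
    rw [Set.range_list_map]
    intro x hx
    obtain ⟨y, hy, rfl⟩ := hw x hx
    exact ⟨⟨y, hy⟩, rfl⟩
  obtain ⟨v, rfl⟩ := this
  exact ⟨v.map Subtype.val, fun x hx => by
    obtain ⟨y, -, rfl⟩ := List.mem_map.1 hx
    exact y.2, by simp⟩

namespace IsHom

variable {P : Data L} {P' : Data L'} {β : L → L'}

theorem map_one (hβ : IsHom P P' β) (hP : IsPartialGroup P) : β P.one = P'.one :=
  (hβ.2 [] hP.nil_mem).symm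

theorem map_mul (hβ : IsHom P P' β) {a b : L} (h : [a, b] ∈ P.D) :
    β (P.pi [a, b]) = P'.pi [β a, β b] :=
  (hβ.2 _ h).symm

theorem map_inv (hβ : IsHom P P' β) (hP : IsPartialGroup P) (hP' : IsPartialGroup P') (a : L) :
    β (P.inv a) = P'.inv (β a) := by
  have h := hP.mul_inv_mem a
  refine hP'.eq_inv_of_mul_eq_one (hβ.1 _ h) ?_
  rw [← hβ.map_one hP, ← hP.mul_inv a, hβ.map_mul h]

theorem map_mem_Dconj (hβ : IsHom P P' β) (hP : IsPartialGroup P) (hP' : IsPartialGroup P')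
    {x f : L} (h : x ∈ P.Dconj f) : β x ∈ P'.Dconj (β f) := by
  have := hβ.1 _ h
  simpa [Data.Dconj, hβ.map_inv hP hP'] using this

theorem map_conj (hβ : IsHom P P' β) (hP : IsPartialGroup P) (hP' : IsPartialGroup P')
    {x f : L} (h : x ∈ P.Dconj f) : β (P.conj x f) = P'.conj (β x) (β f) := by
  have := hβ.2 _ h
  simpa [Data.conj, hβ.map_inv hP hP'] using this.symm

theorem isSubgroup_image (hβ : IsHom P P' β) (hP : IsPartialGroup P) (hP' : IsPartialGroup P')
    {H : Set L} (hH : P.IsSubgroup H) : P'.IsSubgroup (β '' H) := by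
  refine .of_closed hP' ?_ ⟨_, hH.one_mem, hβ.map_one hP⟩ ?_ ?_
  · intro w hw
    obtain ⟨v, hv, rfl⟩ := exists_word_map_eq hw
    exact hβ.1 _ (hH.word_mem hv)
  · rintro _ ⟨x, hx, rfl⟩
    exact ⟨_, hH.inv_mem hx, hβ.map_inv hP hP' x⟩
  · rintro _ ⟨x, hx, rfl⟩ _ ⟨y, hy, rfl⟩
    exact ⟨_, hH.mul_mem hx hy, hβ.map_mul (hH.word_mem (by simp [hx, hy]))⟩

theorem isSubgroup_inter_preimage (hβ : IsHom P P' β) (hP : IsPartialGroup P)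
    (hP' : IsPartialGroup P') {H : Set L} {H' : Set L'} (hH : P.IsSubgroup H)
    (hH' : P'.IsSubgroup H') : P.IsSubgroup (H ∩ β ⁻¹' H') := by
  refine .of_subset hP hH Set.inter_subset_left ?_ ?_ ?_
  · refine ⟨hH.one_mem, ?_⟩
    rw [Set.mem_preimage, hβ.map_one hP]
    exact hH'.one_mem
  · rintro a ⟨ha, ha'⟩
    refine ⟨hH.inv_mem ha, ?_⟩
    rw [Set.mem_preimage, hβ.map_inv hP hP']
    exact hH'.inv_mem ha'
  · rintro a ⟨ha, ha'⟩ b ⟨hb, hb'⟩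
    refine ⟨hH.mul_mem ha hb, ?_⟩
    rw [Set.mem_preimage, hβ.map_mul (hH.word_mem (by simp [ha, hb]))]
    exact hH'.mul_mem ha' hb'

end IsHom

/-- A projection of localities with central kernel. -/
structure IsCentralProj (p : ℕ) (P : Data L) (Δ : Set (Set L)) (S : Set L) (P' : Data L')
    (Δ' : Set (Set L')) (S' : Set L') (β : L → L') : Prop where
  source : IsLocality p P Δ S
  target : IsLocality p P' Δ' S'
  proj : IsLocalityProj P P' Δ Δ' β
  ker_subset : pgKer P P' β ⊆ P.center

namespace IsCentralProj

variable {p : ℕ} {P : Data L} {Δ : Set (Set L)} {S : Set L} {P' : Data L'}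
  {Δ' : Set (Set L')} {S' : Set L'} {β : L → L'}

theorem isHom (h : IsCentralProj p P Δ S P' Δ' S' β) : IsHom P P' β := h.proj.1.1

theorem pg (h : IsCentralProj p P Δ S P' Δ' S' β) : IsPartialGroup P := h.source.isPartialGroup

theorem pg' (h : IsCentralProj p P Δ S P' Δ' S' β) : IsPartialGroup P' := h.target.isPartialGroup

theorem map_inv (h : IsCentralProj p P Δ S P' Δ' S' β) (a : L) : β (P.inv a) = P'.inv (β a) :=
  h.isHom.map_inv h.pg h.pg' a

theorem map_conj (h : IsCentralProj p P Δ S P' Δ' S' β) {x f : L} (hx : x ∈ P.Dconj f) :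
    β (P.conj x f) = P'.conj (β x) (β f) :=
  h.isHom.map_conj h.pg h.pg' hx

theorem map_conjSet (h : IsCentralProj p P Δ S P' Δ' S' β) {X : Set L} {f : L}
    (hX : X ⊆ P.Dconj f) : P'.conjSet (β '' X) (β f) = β '' P.conjSet X f := by
  rw [Data.conjSet, Data.conjSet, Set.image_image, Set.image_image]
  exact Set.image_congr fun x hx => (h.map_conj (hX hx)).symm

theorem image_s (h : IsCentralProj p P Δ S P' Δ' S' β) : β '' S = S' := by
  apply subset_antisymm
  · exact (h.target.delta_subgroups _ (h.proj.2 ▸ ⟨S, h.source.s_mem, rfl⟩)).2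
  · have := h.target.s_mem
    rw [← h.proj.2] at this
    obtain ⟨A, hA, rfl⟩ := this
    exact Set.image_mono (h.source.delta_subgroups A hA).2

theorem exists_conjRel_of_map_mem (h : IsCentralProj p P Δ S P' Δ' S' β) {g : L}
    (hg : β g ∈ S') : ∃ s ∈ S, ∀ A ∈ Δ, ConjRel P Δ g A (P.conjSet A s) := by
  rw [← h.image_s] at hg
  obtain ⟨s, hs, hsg⟩ := hg
  have hP := h.pg
  have hD : [g, P.inv s] ∈ P.D :=
    h.source.mem_D_of_path (.cons (h.source.conjRel_SOf g)
      (h.source.conjRel_of_mem (h.source.SOf_mem _) (h.source.pSubgroup.1.inv_mem hs)).path)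
  have hz : P.pi [g, P.inv s] ∈ P.center := by
    apply h.ker_subset
    change β (P.pi [g, P.inv s]) = P'.one
    rw [h.isHom.map_mul hD, h.map_inv, hsg, h.pg'.mul_inv]
  refine ⟨s, hs, fun A hA => ?_⟩
  rw [← (hP.mul_inv_cancel_right hD).2]
  exact h.source.conjRel_mul (conjRel_of_mem_center hA hz) (h.source.conjRel_of_mem hA hs)

theorem isSubgroup_preimage_s (h : IsCentralProj p P Δ S P' Δ' S' β) :
    P.IsSubgroup (β ⁻¹' S') := by
  have hS' := h.target.pSubgroup.1
  have hW : Wrd (β ⁻¹' S') ⊆ P.D := by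
    intro w hw
    have key : ∀ A ∈ Δ, ∃ B, ConjPath P Δ w A B := by
      induction w with
      | nil => exact fun A hA => ⟨A, .nil hA⟩
      | cons g w ih =>
        intro A hA
        obtain ⟨s, -, hs⟩ := h.exists_conjRel_of_map_mem (hw g List.mem_cons_self)
        obtain ⟨B, hB⟩ := ih (fun x hx => hw x (List.mem_cons_of_mem _ hx)) _ (hs A hA).right_mem
        exact ⟨B, .cons (hs A hA) hB⟩
    obtain ⟨B, hB⟩ := key S h.source.s_mem
    exact h.source.mem_D_of_path hB
  refine .of_closed h.pg hW ?_ ?_ ?_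
  · rw [Set.mem_preimage, h.isHom.map_one h.pg]
    exact hS'.one_mem
  · intro a ha
    rw [Set.mem_preimage, h.map_inv]
    exact hS'.inv_mem ha
  · intro a ha b hb
    rw [Set.mem_preimage, h.isHom.map_mul (hW (by simp_all [Wrd]))]
    exact hS'.mul_mem ha hb

/-- Every `p`-subgroup of the preimage of `S'` lies in `S`. -/
theorem mem_s_of_isPGroup (h : IsCentralProj p P Δ S P' Δ' S' β) [Fact p.Prime] :
    letI := h.isSubgroup_preimage_s.group h.pg
    ∀ K : Subgroup (β ⁻¹' S'), IsPGroup p K → ∀ x ∈ K, x.1 ∈ S := by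
  let := h.isSubgroup_preimage_s.group h.pg
  have := h.source.finite
  have hP := h.pg
  intro K hK x hx
  obtain ⟨Q, hQ⟩ := h.isSubgroup_preimage_s.exists_sylow h.pg h.source.pSubgroup
    (Set.image_subset_iff.1 h.image_s.subset) fun X _ => h.source.s_maximal X
  have hn : (Q : Subgroup (β ⁻¹' S')).Normal := by
    refine ⟨fun n hn g => (hQ _).2 ?_⟩
    obtain ⟨s, hs, hc⟩ := h.exists_conjRel_of_map_mem (g⁻¹).2
    have hrel := hc S h.source.s_mem
    rw [h.source.conjSet_eq_self h.source.pSubgroup.1 hs] at hrel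
    have hn' := (hQ n).1 hn
    have hmem := hrel.conj_mem hn'
    have e := hP.assoc_pi [] [g.1, n.1] [P.inv g.1]
      (h.isSubgroup_preimage_s.word_mem (by
        simpa using ⟨g.2, n.2, h.isSubgroup_preimage_s.inv_mem g.2⟩))
    have hmem' : P.pi [P.inv (P.inv g.1), n.1, P.inv g.1] ∈ S := hmem
    rw [hP.inv_inv] at hmem'
    exact (congrArg (· ∈ S) e).mp hmem'
  obtain ⟨Q', hQ'⟩ := hK.exists_le_sylow
  have := Sylow.unique_of_normal Q hn
  exact (hQ x).1 (Subsingleton.elim Q' Q ▸ hQ' hx)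

theorem mem_SOf_of_map_mem (h : IsCentralProj p P Δ S P' Δ' S' β) [Fact p.Prime] {f s : L}
    (hs : s ∈ S) (hfs : β s ∈ P'.SOf S' (β f)) : s ∈ P.SOf S f := by
  have hP := h.pg
  have := h.source.finite
  have hS := h.source.pSubgroup
  have hG := h.isSubgroup_preimage_s
  have hA := h.source.isSubgroup_SOf f
  have hB := h.isHom.isSubgroup_inter_preimage hP h.pg' hS.1 (h.target.isSubgroup_SOf (β f))
  let := hS.1.group hP
  let := hG.group hP
  let A : Subgroup S := hA.subgroupOf hS.1 hP
  let B : Subgroup S := hB.subgroupOf hS.1 hP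
  by_contra hsf
  have hAB : A < B := by
    refine lt_of_le_of_ne (fun x hx => ⟨x.2, ?_⟩) fun e => hsf ?_
    · have hx' : x.1 ∈ P.SOf S f := hx
      refine ⟨h.image_s.subset ⟨_, x.2, rfl⟩, h.isHom.map_mem_Dconj hP h.pg' hx'.2.1, ?_⟩
      rw [← h.map_conj hx'.2.1]
      exact h.image_s.subset ⟨_, hx'.2.2, rfl⟩
    · have : (⟨s, hs⟩ : S) ∈ B := ⟨hs, hfs⟩
      rw [← e] at this
      exact this
  obtain ⟨y, hyB, hyA, hyN⟩ := (hS.isPGroup hP).exists_mem_normalizer hAB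
  have hconj : ∀ x ∈ Subgroup.normalizer (A : Set S), ∀ a ∈ P.SOf S f,
      P.conj a x.1 ∈ P.SOf S f := by
    intro x hx a ha
    have h1 := (Subgroup.mem_normalizer_iff''.1 hx ⟨a, ha.1⟩).1 ha
    have e := hP.assoc_pi [] [P.inv x.1, a] [x.1]
      (hS.1.word_mem (by simp [hS.1.inv_mem x.2, ha.1]))
    exact (congrArg (· ∈ P.SOf S f) e).mpr h1
  have hrel : ∀ x ∈ Subgroup.normalizer (A : Set S),
      ConjRel P Δ x.1 (P.SOf S f) (P.SOf S f) := by
    intro x hx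
    have h1 := h.source.conjRel_of_mem (h.source.SOf_mem f) x.2
    convert h1
    refine subset_antisymm (fun a ha => ?_) ?_
    · exact ⟨_, hconj x⁻¹ (inv_mem hx) a ha,
        hP.conj_inv_conj (hS.1.mem_Dconj ha.1 (hS.1.inv_mem x.2))⟩
    · rintro _ ⟨a, ha, rfl⟩
      exact hconj x hx a ha
  let N : Subgroup S := B ⊓ Subgroup.normalizer (A : Set S)
  have hf := h.source.conjRel_SOf f
  have hf' := h.source.conjRel_inv hf
  have hD : ∀ x ∈ N, x.1 ∈ P.Dconj f := fun x hx =>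
    h.source.mem_D_of_path (.cons hf' (.cons (hrel x hx.2) hf.path))
  let φ : N →* (β ⁻¹' S' : Set L) := MonoidHom.mk'
    (fun x => ⟨P.conj x.1.1 f, by
      rw [Set.mem_preimage, h.map_conj (hD x.1 x.2)]
      exact x.2.1.2.2.2⟩)
    fun x y => Subtype.ext (hP.conj_mul (h.source.mem_D_of_path (.cons hf'
      (.cons (hrel x.1 x.2.2) (.cons hf (.cons hf' (.cons (hrel y.1 y.2.2) hf.path))))))).2
  have hφ := h.mem_s_of_isPGroup φ.range
    (((hS.isPGroup hP).to_subgroup N).of_surjective φ.rangeRestrict φ.rangeRestrict_surjective)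
    (φ ⟨y, hyB, hyN⟩) ⟨_, rfl⟩
  exact hyA ⟨y.2, hD y ⟨hyB, hyN⟩, hφ⟩

theorem inter_preimage_mem (h : IsCentralProj p P Δ S P' Δ' S' β) {A' : Set L'} (hA' : A' ∈ Δ') :
    S ∩ β ⁻¹' A' ∈ Δ := by
  have hsub := h.isHom.isSubgroup_inter_preimage h.pg h.pg' h.source.pSubgroup.1
    (h.target.delta_subgroups A' hA').1
  rw [← h.proj.2] at hA'
  obtain ⟨A, hA, rfl⟩ := hA'
  exact h.source.mem_of_subset hA hsub
    (Set.subset_inter (h.source.delta_subgroups A hA).2 (Set.subset_preimage_image β A))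
    Set.inter_subset_left

theorem lift_conjRel (h : IsCentralProj p P Δ S P' Δ' S' β) [Fact p.Prime] {f : L}
    {A' B' : Set L'} (hf : ConjRel P' Δ' (β f) A' B') :
    ConjRel P Δ f (S ∩ β ⁻¹' A') (S ∩ β ⁻¹' B') := by
  have key : ∀ {f : L} {A' B' : Set L'}, ConjRel P' Δ' (β f) A' B' →
      ∀ x ∈ S ∩ β ⁻¹' A', x ∈ P.Dconj f ∧ P.conj x f ∈ S ∩ β ⁻¹' B' := by
    intro f A' B' hf x hx
    have hxf := h.mem_SOf_of_map_mem hx.1 (h.target.subset_SOf hf hx.2)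
    refine ⟨hxf.2.1, hxf.2.2, ?_⟩
    rw [Set.mem_preimage, h.map_conj hxf.2.1]
    exact hf.conj_mem hx.2
  refine ⟨h.inter_preimage_mem hf.left_mem, h.inter_preimage_mem hf.right_mem,
    fun x hx => (key hf x hx).1, subset_antisymm ?_ fun y hy => ?_⟩
  · rintro _ ⟨x, hx, rfl⟩
    exact (key hf x hx).2
  · have hi := key (f := P.inv f) (h.map_inv f ▸ h.target.conjRel_inv hf) y hy
    exact ⟨_, hi.2, h.pg.conj_inv_conj hi.1⟩

theorem lift_conjPath (h : IsCentralProj p P Δ S P' Δ' S' β) [Fact p.Prime] {w : List L}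
    {A' B' : Set L'} (hw : ConjPath P' Δ' (w.map β) A' B') :
    ConjPath P Δ w (S ∩ β ⁻¹' A') (S ∩ β ⁻¹' B') := by
  induction w generalizing A' with
  | nil =>
    cases hw with
    | nil hA => exact .nil (h.inter_preimage_mem hA)
  | cons f w ih =>
    cases hw with
    | cons hf hw => exact .cons (h.lift_conjRel hf) (ih hw)

theorem mem_D_of_map_mem (h : IsCentralProj p P Δ S P' Δ' S' β) [Fact p.Prime] {w : List L}
    (hw : w.map β ∈ P'.D) : w ∈ P.D :=
  have ⟨_, _, hc⟩ := h.target.mem_D_iff.1 hw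
  h.source.mem_D_of_path (h.lift_conjPath hc)

end IsCentralProj

namespace IsCentralProj

variable {p : ℕ} {P : Data L} {Δ : Set (Set L)} {S : Set L} {P' : Data L'}
  {Δ' : Set (Set L')} {S' : Set L'} {β : L → L'} {L₀ : Set L} {Δ₀ : Set (Set L)} {S₀ : Set L}

theorem isPSubgroup_image (h : IsCentralProj p P Δ S P' Δ' S' β) [Fact p.Prime] {H : Set L}
    (hH : P.IsPSubgroup p H) : P'.IsPSubgroup p (β '' H) := by
  have hP := h.pg
  have hP' := h.pg'
  have := h.source.finite
  have hH' := h.isHom.isSubgroup_image hP hP' hH.1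
  let := hH.1.group hP
  let := hH'.group hP'
  let φ : H →* (β '' H : Set L') := MonoidHom.mk' (fun x => ⟨β x.1, x.1, x.2, rfl⟩)
    fun x y => Subtype.ext (h.isHom.map_mul (hH.1.word_mem (by simp)))
  have hφ : Function.Surjective φ := by
    rintro ⟨_, x, hx, rfl⟩
    exact ⟨⟨x, hx⟩, rfl⟩
  obtain ⟨n, hn⟩ := IsPGroup.iff_card.1 ((hH.isPGroup hP).of_surjective φ hφ)
  exact ⟨hH', n, (Nat.card_coe_set_eq _).symm.trans hn⟩

theorem isPartialSubgroup_image (h : IsCentralProj p P Δ S P' Δ' S' β) [Fact p.Prime]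
    (hL₀ : P.IsPartialSubgroup L₀) : P'.IsPartialSubgroup (β '' L₀) := by
  constructor
  · rintro _ ⟨x, hx, rfl⟩
    exact ⟨_, hL₀.1 x hx, h.map_inv x⟩
  · rintro w ⟨hw, hD⟩
    obtain ⟨v, hv, rfl⟩ := exists_word_map_eq hw
    have hvD := h.mem_D_of_map_mem hD
    exact ⟨_, hL₀.2 v ⟨hv, hvD⟩, (h.isHom.2 v hvD).symm⟩

/-- Every subgroup of the image of `L₀` has a full preimage in `L₀` which is a subgroup. -/
theorem isSubgroup_inter_preimage (h : IsCentralProj p P Δ S P' Δ' S' β) [Fact p.Prime]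
    (hL₀ : P.IsPartialSubgroup L₀) {T : Set L'} (hT : P'.IsSubgroup T) :
    P.IsSubgroup (L₀ ∩ β ⁻¹' T) := by
  have hW : Wrd (L₀ ∩ β ⁻¹' T) ⊆ P.D := fun w hw =>
    h.mem_D_of_map_mem (hT.word_mem (by
      simp only [List.mem_map]
      rintro _ ⟨x, hx, rfl⟩
      exact (hw x hx).2))
  refine ⟨⟨fun f hf => ⟨hL₀.1 f hf.1, ?_⟩, ?_⟩, hW⟩
  · rw [Set.mem_preimage, h.map_inv]
    exact hT.inv_mem hf.2
  · rintro w ⟨hw, hD⟩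
    refine ⟨hL₀.2 w ⟨fun x hx => (hw x hx).1, hD⟩, ?_⟩
    rw [Set.mem_preimage, ← h.isHom.2 w hD]
    refine hT.pi_mem ?_
    simp only [List.mem_map]
    rintro _ ⟨x, hx, rfl⟩
    exact (hw x hx).2

/-- The image of a maximal `p`-subgroup of `L₀` is a maximal `p`-subgroup of the image. -/
theorem image_maximal (h : IsCentralProj p P Δ S P' Δ' S' β) [Fact p.Prime]
    (h₀ : IsLocalityIn p P L₀ Δ₀ S₀) {T : Set L'} (hTL : T ⊆ β '' L₀)
    (hT : P'.IsPSubgroup p T) (hST : β '' S₀ ⊆ T) : T = β '' S₀ := by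
  have hP := h.pg
  have := h.source.finite
  have hM := h.isSubgroup_inter_preimage h₀.partialSubgroup hT.1
  obtain ⟨Q, hQ⟩ := hM.exists_sylow hP h₀.pSubgroup
    (Set.subset_inter h₀.s_sub (Set.image_subset_iff.1 hST))
    fun X hX => h₀.s_maximal X (hX.trans Set.inter_subset_left)
  let := hM.group hP
  let := hT.1.group h.pg'
  let φ : (L₀ ∩ β ⁻¹' T : Set L) →* T := MonoidHom.mk' (fun x => ⟨β x.1, x.2.2⟩)
    fun x y => Subtype.ext (h.isHom.map_mul (hM.word_mem (by
      rintro a ha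
      rcases List.mem_pair.1 ha with rfl | rfl
      exacts [x.2, y.2])))
  have hφ : Function.Surjective φ := by
    rintro ⟨y, hy⟩
    obtain ⟨x, hx, rfl⟩ := hTL hy
    exact ⟨⟨x, hx, hy⟩, rfl⟩
  refine subset_antisymm (fun y hy => ?_) hST
  have htop : (Q.mapSurjective hφ : Subgroup T) = ⊤ :=
    ((Q.mapSurjective hφ).is_maximal' ((hT.isPGroup h.pg').to_subgroup ⊤) le_top).symm
  have hmem : (⟨y, hy⟩ : T) ∈ (Q.mapSurjective hφ : Subgroup T) := htop ▸ Subgroup.mem_top _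
  obtain ⟨x, hx, hxy⟩ := hmem
  exact ⟨x.1, (hQ x).1 hx, congrArg Subtype.val hxy⟩

theorem inter_image (h : IsCentralProj p P Δ S P' Δ' S' β) [Fact p.Prime]
    (h₀ : IsSubLocality p P S L₀ Δ₀ S₀) : S' ∩ β '' L₀ = β '' S₀ := by
  have := h.target.finite
  have hS' := h.target.pSubgroup
  have hL' := h.isPartialSubgroup_image h₀.2.partialSubgroup
  have hsub : P'.IsSubgroup (S' ∩ β '' L₀) :=
    ⟨⟨fun f hf => ⟨hS'.1.inv_mem hf.1, hL'.1 f hf.2⟩, fun w hw =>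
      ⟨hS'.1.pi_mem fun x hx => (hw.1 x hx).1, hL'.2 w ⟨fun x hx => (hw.1 x hx).2, hw.2⟩⟩⟩,
      fun w hw => hS'.1.word_mem fun x hx => (hw x hx).1⟩
  have hp : P'.IsPSubgroup p (S' ∩ β '' L₀) := by
    let := hS'.1.group h.pg'
    have := hS'.1.isPSubgroup_image_val h.pg' (hsub.subgroupOf hS'.1 h.pg')
      ((hS'.isPGroup h.pg').to_subgroup _)
    convert this
    ext x
    exact ⟨fun hx => ⟨⟨x, hx.1⟩, hx, rfl⟩, by rintro ⟨x, hx, rfl⟩; exact hx⟩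
  refine h.image_maximal h₀.2 Set.inter_subset_right hp ?_
  rw [h₀.1, ← h.image_s]
  exact Set.image_inter_subset β S L₀

/-- If `g ∈ L₀` and `Q ⊆ S₀` is such that the image of `Q` is conjugated into `S₀β` by `gβ`,
then `Q` is conjugated into `S₀` by `g`. -/
theorem lift_conj_mem (h : IsCentralProj p P Δ S P' Δ' S' β) [Fact p.Prime]
    (h₀ : IsSubLocality p P S L₀ Δ₀ S₀) {Q : Set L} (hQ : Q ⊆ S₀) {g : L} (hg : g ∈ L₀)
    (hD : β '' Q ⊆ P'.Dconj (β g)) (hc : P'.conjSet (β '' Q) (β g) ⊆ β '' S₀) :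
    Q ⊆ P.SOf S g ∧ P.conjSet Q g ⊆ S₀ := by
  have hS₀ : S₀ ⊆ S := h₀.1 ▸ Set.inter_subset_left
  have hmem : Q ⊆ P.SOf S g := fun x hx =>
    h.mem_SOf_of_map_mem (hS₀ (hQ hx))
      ⟨h.image_s ▸ Set.mem_image_of_mem β (hS₀ (hQ hx)), hD ⟨x, hx, rfl⟩,
        h.image_s ▸ Set.image_mono hS₀ (hc ⟨_, ⟨x, hx, rfl⟩, rfl⟩)⟩
  refine ⟨hmem, ?_⟩
  rintro _ ⟨x, hx, rfl⟩
  rw [h₀.1]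
  refine ⟨(hmem hx).2.2, h₀.2.partialSubgroup.2 _ ⟨?_, (hmem hx).2.1⟩⟩
  simp [Wrd, hg, h₀.2.partialSubgroup.1 g hg, h₀.2.s_sub (hQ hx)]

theorem lift_chainFrom (h : IsCentralProj p P Δ S P' Δ' S' β) [Fact p.Prime]
    (h₀ : IsSubLocality p P S L₀ Δ₀ S₀) {w : List L} (hw : w ∈ Wrd L₀) {Q : Set L}
    (hQ : Q ∈ Δ₀) (hc : chainFrom P' (Set.image β '' Δ₀) (w.map β) (β '' Q)) :
    chainFrom P Δ₀ w Q := by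
  induction w generalizing Q with
  | nil => trivial
  | cons f w ih =>
    obtain ⟨h1, h2, h3⟩ := hc
    have hf := hw f List.mem_cons_self
    obtain ⟨hQs, hQS⟩ := h₀.2.delta_subgroups Q hQ
    have hsub : P'.conjSet (β '' Q) (β f) ⊆ β '' S₀ := by
      obtain ⟨R, hR, hRe⟩ := h2
      exact hRe ▸ Set.image_mono (h₀.2.delta_subgroups R hR).2
    obtain ⟨h4, h5⟩ := h.lift_conj_mem h₀ hQS hf h1 hsub
    have hD : Q ⊆ P.Dconj f := fun x hx => (h4 hx).2.1
    have hmem : P.conjSet Q f ∈ Δ₀ := h₀.2.delta_closed _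
      (h.source.isSubgroup_conjSet (h.source.conjRel_SOf f) hQs h4) h5
      ⟨Q, hQ, f, hf, hD, subset_rfl⟩
    rw [h.map_conjSet hD] at h3
    exact ⟨hD, hmem, ih (fun x hx => hw x (List.mem_cons_of_mem _ hx)) hmem h3⟩

theorem map_chainFrom (h : IsCentralProj p P Δ S P' Δ' S' β) {w : List L} {Q : Set L}
    (hc : chainFrom P Δ₀ w Q) : chainFrom P' (Set.image β '' Δ₀) (w.map β) (β '' Q) := by
  induction w generalizing Q with
  | nil => trivial
  | cons f w ih =>
    obtain ⟨h1, h2, h3⟩ := hc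
    rw [List.map_cons, chainFrom, h.map_conjSet h1]
    refine ⟨?_, ⟨_, h2, rfl⟩, ih h3⟩
    rintro _ ⟨x, hx, rfl⟩
    exact h.isHom.map_mem_Dconj h.pg h.pg' (h1 hx)

theorem isLocalityIn_image (h : IsCentralProj p P Δ S P' Δ' S' β) [Fact p.Prime]
    (h₀ : IsSubLocality p P S L₀ Δ₀ S₀) :
    IsLocalityIn p P' (β '' L₀) (Set.image β '' Δ₀) (β '' S₀) where
  partialSubgroup := h.isPartialSubgroup_image h₀.2.partialSubgroup
  finite := h₀.2.finite.image β
  pSubgroup := h.isPSubgroup_image h₀.2.pSubgroup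
  s_sub := Set.image_mono h₀.2.s_sub
  delta_nonempty := h₀.2.delta_nonempty.image _
  delta_subgroups := by
    rintro _ ⟨Q, hQ, rfl⟩
    have := h₀.2.delta_subgroups Q hQ
    exact ⟨h.isHom.isSubgroup_image h.pg h.pg' this.1, Set.image_mono this.2⟩
  s_maximal _ hTL hT hST := h.image_maximal h₀.2 hTL hT hST
  d_eq := by
    intro w hw
    obtain ⟨v, hv, rfl⟩ := exists_word_map_eq hw
    constructor
    · intro hD
      obtain ⟨Q, hQ, hc⟩ := (h₀.2.d_eq v hv).1 (h.mem_D_of_map_mem hD)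
      exact ⟨_, ⟨Q, hQ, rfl⟩, h.map_chainFrom hc⟩
    · rintro ⟨_, ⟨Q, hQ, rfl⟩, hc⟩
      exact h.isHom.1 v ((h₀.2.d_eq v hv).2 ⟨Q, hQ, h.lift_chainFrom h₀ hv hQ hc⟩)
  delta_closed := by
    rintro Q' hQ' hQS ⟨_, ⟨R, hR, rfl⟩, _, ⟨g, hg, rfl⟩, hD, hc⟩
    obtain ⟨hRg, hRc⟩ := h.lift_conj_mem h₀ (h₀.2.delta_subgroups R hR).2 hg hD (hc.trans hQS)
    have hRD : R ⊆ P.Dconj g := fun x hx => (hRg hx).2.1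
    refine ⟨S₀ ∩ β ⁻¹' Q', h₀.2.delta_closed _
      (h.isHom.isSubgroup_inter_preimage h.pg h.pg' h₀.2.pSubgroup.1 hQ') Set.inter_subset_left
      ⟨R, hR, g, hg, hRD, Set.subset_inter hRc ?_⟩, ?_⟩
    · rw [← Set.image_subset_iff, ← h.map_conjSet hRD]
      exact hc
    · rw [Set.image_inter_preimage]
      exact Set.inter_eq_right.2 hQS

theorem isLocalityProjBetween_image (h : IsCentralProj p P Δ S P' Δ' S' β) [Fact p.Prime]
    (L₀ : Set L) (Δ₀ : Set (Set L)) :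
    IsLocalityProjBetween P P' L₀ Δ₀ (β '' L₀) (Set.image β '' Δ₀) β := by
  refine ⟨⟨rfl, ⟨fun w hw => h.isHom.1 w hw.1, fun w hw => h.isHom.2 w hw.1⟩, ?_⟩, rfl⟩
  rintro w ⟨hD, hw⟩
  obtain ⟨v, hv, rfl⟩ := exists_word_map_eq hw
  exact ⟨v, ⟨h.mem_D_of_map_mem hD, hv⟩, rfl⟩

end IsCentralProj

/-- Lemma 3.14: let `(L,Δ,S)` and `(L',Δ',S')` be localities and `β : L → L'` a
projection of localities from `(L,Δ,S)` to `(L',Δ',S')` with `ker(β) ⊆ Z(L)`, and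
let `(L₀,Δ₀,S₀)` be a sublocality of `(L,Δ,S)`.  Then `(L₀β,Δ₀β,S₀β)` is a
sublocality of `(L',Δ',S')` and `β|_{L₀} : L₀ → L₀β` is a projection of localities
from `(L₀,Δ₀,S₀)` to `(L₀β,Δ₀β,S₀β)`. -/
theorem sublocality_image_of_projection (p : ℕ) (hp : p.Prime)
    (P : Data L) (Δ : Set (Set L)) (S : Set L)
    (P' : Data L') (Δ' : Set (Set L')) (S' : Set L')
    (hloc : IsLocality p P Δ S) (hloc' : IsLocality p P' Δ' S')
    (β : L → L') (hβ : IsLocalityProj P P' Δ Δ' β)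
    (hker : pgKer P P' β ⊆ P.center)
    (L₀ : Set L) (Δ₀ : Set (Set L)) (S₀ : Set L)
    (hsub : IsSubLocality p P S L₀ Δ₀ S₀) :
    IsSubLocality p P' S' (β '' L₀) (Set.image β '' Δ₀) (β '' S₀) ∧
    IsLocalityProjBetween P P' L₀ Δ₀ (β '' L₀) (Set.image β '' Δ₀) β := by
  have := Fact.mk hp
  have h : IsCentralProj p P Δ S P' Δ' S' β := ⟨hloc, hloc', hβ, hker⟩
  exact ⟨⟨(h.inter_image hsub).symm, h.isLocalityIn_image hsub⟩,
    h.isLocalityProjBetween_image L₀ Δ₀⟩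

end PartialGroups
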